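/- Closedness under stretching of the dyadic output grid: let N ≥ 1 be an integer and let G be the LGL grid of order N on [−1,1], i.e., the grid −1 = ξ_0^N < ⋯ < ξ_N^N = 1. Assume G has the stretching property: for every interval I ∈ P(G) with I ⊆ (−1,−1/2] and every interval I′ ∈ P(G) with L(I) ∩ I′ ≠ ∅, where L(x) = 2x+1, one has |I′| ≤ |L(I)|. Let α ≥ 1, let P₀ be a dyadic partition of [−1,1] whose associated dyadic grid is symmetric, monotonic, and closed under stretching, and let P be an α-output for (G,P₀). Then the dyadic grid associated with P is closed under stretching. -/

import Mathlib

/-- The Legendre polynomial of degree `N` via the Rodrigues formula. -/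
noncomputable def legendrePoly (N : ℕ) : Polynomial ℝ :=
  Polynomial.C (1 / (2 ^ N * N.factorial : ℝ)) *
    Polynomial.derivative^[N] ((Polynomial.X ^ 2 - 1) ^ N)

/-- The polynomial `(1 - x²)·L_N'(x)` whose zeros are the LGL nodes of order `N`. -/
noncomputable def lglPoly (N : ℕ) : Polynomial ℝ :=
  (1 - Polynomial.X ^ 2) * Polynomial.derivative (legendrePoly N)

/-- `ξ 0 < ξ 1 < ⋯ < ξ N` enumerates the Legendre-Gauss-Lobatto nodes of order `N`
in increasing order. -/
def IsLGLNodes (N : ℕ) (ξ : ℕ → ℝ) : Prop :=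
  StrictMonoOn ξ (Set.Iic N) ∧ ξ 0 = -1 ∧ ξ N = 1 ∧
    (∀ k ≤ N, (lglPoly N).eval (ξ k) = 0) ∧
    (∀ x : ℝ, (lglPoly N).eval x = 0 → ∃ k ≤ N, ξ k = x)

/-- The standard dyadic subinterval of `[a,b]` of level `p.1` and index `p.2`,
namely `[a + (b-a)·k·2^{-j}, a + (b-a)·(k+1)·2^{-j}]` for `p = (j,k)`. -/
def dInt (a b : ℝ) (p : ℕ × ℕ) : Set ℝ :=
  Set.Icc (a + (b - a) * p.2 / 2 ^ p.1) (a + (b - a) * (p.2 + 1) / 2 ^ p.1)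

/-- The length `(b-a)·2^{-j}` of a standard dyadic subinterval of level `p.1`. -/
noncomputable def dLen (a b : ℝ) (p : ℕ × ℕ) : ℝ := (b - a) / 2 ^ p.1

/-- The parent `(j-1, k/2)` of the dyadic interval indexed by `p = (j,k)`. -/
def dParent (p : ℕ × ℕ) : ℕ × ℕ := (p.1 - 1, p.2 / 2)

/-- A dyadic partition of `[a,b]`: a finite collection of standard dyadic
subintervals (encoded by their level/index pairs) with pairwise disjoint
interiors, whose union is `[a,b]`. -/
structure DyadicPartition (a b : ℝ) where
  ps : Finset (ℕ × ℕ)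
  valid : ∀ p ∈ ps, p.2 < 2 ^ p.1
  cover : (⋃ p ∈ ps, dInt a b p) = Set.Icc a b
  disj : ∀ p ∈ ps, ∀ q ∈ ps, p ≠ q →
    interior (dInt a b p) ∩ interior (dInt a b q) = ∅

/-- The dyadic grid associated with a dyadic partition: the set of endpoints of
its intervals. -/
def dGridSet {a b : ℝ} (P : DyadicPartition a b) : Set ℝ :=
  ⋃ p ∈ P.ps, ({a + (b - a) * p.2 / 2 ^ p.1, a + (b - a) * (p.2 + 1) / 2 ^ p.1} : Set ℝ)

/-- A grid on `[a,b]`: a finite strictly increasing sequence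
`a = x 0 < x 1 < ⋯ < x M = b`. -/
structure Grid (a b : ℝ) where
  M : ℕ
  M_pos : 0 < M
  x : ℕ → ℝ
  mono : StrictMonoOn x (Set.Iic M)
  left : x 0 = a
  right : x M = b

/-- The `i`-th interval `[x i, x (i+1)]` of the partition induced by a grid. -/
def Grid.interval {a b : ℝ} (G : Grid a b) (i : ℕ) : Set ℝ :=
  Set.Icc (G.x i) (G.x (i + 1))

/-- `m(I,G)`: the minimum length of a grid interval of `G` intersecting `I`. -/
noncomputable def Grid.gmin {a b : ℝ} (G : Grid a b) (I : Set ℝ) : ℝ :=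
  sInf {d : ℝ | ∃ i < G.M, (G.interval i ∩ I).Nonempty ∧ d = G.x (i + 1) - G.x i}

/-- `P` is an α-output of the algorithm `DyadicGrid(G, P₀, α)`:
(a) every interval of `P` is contained in some interval of `P₀`;
(b) every interval `D` of `P` satisfies `|D| ≤ α·m(D,G)`;
(c) every interval `D` of `P` not in `P₀` has a parent `D̂` with
    `|D̂| > α·m(D̂,G)`. -/
def IsAlphaOutput {a b : ℝ} (G : Grid a b) (P₀ P : DyadicPartition a b)
    (α : ℝ) : Prop :=
  (∀ p ∈ P.ps, ∃ q ∈ P₀.ps, dInt a b p ⊆ dInt a b q) ∧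
  (∀ p ∈ P.ps, dLen a b p ≤ α * G.gmin (dInt a b p)) ∧
  (∀ p ∈ P.ps, p ∉ P₀.ps →
    1 ≤ p.1 ∧ dLen a b (dParent p) > α * G.gmin (dInt a b (dParent p)))

/-- A grid is symmetric if `x i + x (M-i) = a + b` for all `0 ≤ i ≤ M`. -/
def Grid.Symmetric {a b : ℝ} (G : Grid a b) : Prop :=
  ∀ i ≤ G.M, G.x i + G.x (G.M - i) = a + b

/-- A grid is monotonic if for any two neighboring intervals contained in the
left half `[a, (a+b)/2]`, the left one is at most as long as the right one. -/
def Grid.Monotonic {a b : ℝ} (G : Grid a b) : Prop :=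
  ∀ i : ℕ, i + 1 < G.M →
    G.interval i ∪ G.interval (i + 1) ⊆ Set.Icc a ((a + b) / 2) →
    G.x (i + 1) - G.x i ≤ G.x (i + 2) - G.x (i + 1)

/-- A grid is locally quasi-uniform with constant `C` if any two intersecting
intervals of its induced partition have length ratio between `C⁻¹` and `C`. -/
def Grid.QuasiUniform {a b : ℝ} (G : Grid a b) (C : ℝ) : Prop :=
  ∀ i < G.M, ∀ j < G.M, (G.interval i ∩ G.interval j).Nonempty →
    C⁻¹ ≤ (G.x (i + 1) - G.x i) / (G.x (j + 1) - G.x j) ∧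
    (G.x (i + 1) - G.x i) / (G.x (j + 1) - G.x j) ≤ C

/-- The dyadic grid associated with `P` is symmetric (around the midpoint of
`[a,b]`). -/
def DyadicPartition.SymmetricGrid {a b : ℝ} (P : DyadicPartition a b) : Prop :=
  ∀ x ∈ dGridSet P, a + b - x ∈ dGridSet P

/-- The partition `P` is monotonic: for any two of its intervals contained in
the left half `[a, (a+b)/2]`, with the second the right neighbor of the first,
the left one is at most as long as the right one. -/
def DyadicPartition.Monotonic {a b : ℝ} (P : DyadicPartition a b) : Prop :=
  ∀ p ∈ P.ps, ∀ q ∈ P.ps,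
    dInt a b p ∪ dInt a b q ⊆ Set.Icc a ((a + b) / 2) →
    a + (b - a) * (p.2 + 1) / 2 ^ p.1 = a + (b - a) * q.2 / 2 ^ q.1 →
    dLen a b p ≤ dLen a b q

/-- A set `D ⊆ [a,b]` (e.g. a dyadic grid) is closed under the stretching map
`L(x) = 2x - a` defined on `[a, (a+b)/2]`. -/
def ClosedUnderStretching (a b : ℝ) (D : Set ℝ) : Prop :=
  ∀ x ∈ D, x ≤ (a + b) / 2 → 2 * x - a ∈ D

open Polynomial in
/-- The iterated derivatives of `(X² - 1)^N` satisfy a three-term differential relation. -/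
lemma iterate_derivative_sq_sub_one_pow (N k : ℕ) :
    (X ^ 2 - 1 : ℝ[X]) * derivative^[k + 2] ((X ^ 2 - 1) ^ N)
      + C (2 * (k + 1) - 2 * N : ℝ) * X * derivative^[k + 1] ((X ^ 2 - 1) ^ N)
      + C ((k + 1) * k - 2 * N * (k + 1) : ℝ) * derivative^[k] ((X ^ 2 - 1) ^ N) = 0 := by
  induction k with
  | zero =>
    have h : (X ^ 2 - 1 : ℝ[X]) * derivative ((X ^ 2 - 1) ^ N)
        = C (2 * N : ℝ) * X * (X ^ 2 - 1) ^ N := by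
      rcases N with _ | n
      · simp
      · simp only [derivative_pow, derivative_sub, derivative_X, derivative_one]
        simp only [map_mul, map_natCast, Nat.add_sub_cancel, map_ofNat]
        push_cast
        ring
    have h2 := congrArg derivative h
    simp only [derivative_mul, derivative_sub, derivative_X_pow, derivative_one, derivative_C,
      derivative_X] at h2
    simp only [Function.iterate_succ, Function.iterate_zero, Function.comp, id] at h2 ⊢
    simp only [map_sub, map_mul, map_add, map_natCast, map_ofNat, map_one] at h2 ⊢
    push_cast at h2 ⊢
    linear_combination h2
  | succ k ih =>
    have h2 := congrArg derivative ih
    simp only [derivative_mul, derivative_sub, derivative_X_pow, derivative_one, derivative_C,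
      derivative_X, derivative_add, derivative_zero, ← Function.iterate_succ_apply'] at h2
    simp only [map_sub, map_mul, map_add, map_natCast, map_ofNat, map_one] at h2 ⊢
    push_cast at h2 ⊢
    simp only [add_assoc, Nat.reduceAdd] at h2 ⊢
    linear_combination h2

open Polynomial in
/-- Legendre's differential equation in Sturm–Liouville form. -/
lemma derivative_lglPoly (N : ℕ) :
    derivative (lglPoly N) = - C (N * (N + 1) : ℝ) * legendrePoly N := by
  have h := iterate_derivative_sq_sub_one_pow N N
  have h1 : derivative (legendrePoly N) = C (1 / (2 ^ N * N.factorial : ℝ)) *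
      derivative^[N + 1] ((X ^ 2 - 1) ^ N) := by
    rw [legendrePoly, derivative_C_mul, Function.iterate_succ_apply']
  rw [lglPoly, h1, legendrePoly]
  simp only [derivative_mul, derivative_sub, derivative_X_pow, derivative_one, derivative_C,
    ← Function.iterate_succ_apply', Nat.succ_eq_add_one, add_assoc, Nat.reduceAdd]
  simp only [map_sub, map_mul, map_add, map_natCast, map_ofNat, map_one] at h ⊢
  push_cast at h ⊢
  linear_combination (- C (1 / (2 ^ N * N.factorial : ℝ))) * h

/-- Derivative of the Wronskian-type expression comparing a solution with a shifted sine. -/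
lemma hasDerivAt_wronskian_sin {f V : ℝ → ℝ} {l k a x : ℝ}
    (hU : HasDerivAt (fun x => (1 - x ^ 2) * f x) (V x) x)
    (hV : HasDerivAt V (-l * f x) x) :
    HasDerivAt (fun x => V x * Real.sin (k * (x - a))
        - (1 - x ^ 2) * f x * (k * Real.cos (k * (x - a))))
      (Real.sin (k * (x - a)) * f x * (k ^ 2 * (1 - x ^ 2) - l)) x := by
  have h0 : HasDerivAt (fun x : ℝ => k * (x - a)) k x := by
    simpa using ((hasDerivAt_id x).sub_const a).const_mul k
  have h := (hV.mul h0.sin).sub (hU.mul (h0.cos.const_mul k))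
  refine h.congr_deriv ?_
  ring

/-- Sturm comparison, upper bound: consecutive zeros of a solution of
`U'' = -k² U / (1 - x²)` are at most `π / k` apart. -/
lemma sturm_gap_le {f V : ℝ → ℝ} {k a b : ℝ} (hk : 0 < k)
    (hU : ∀ x, HasDerivAt (fun x => (1 - x ^ 2) * f x) (V x) x)
    (hV : ∀ x, HasDerivAt V (-k ^ 2 * f x) x)
    (ha : -1 ≤ a) (hb : b ≤ 1) (hUa : (1 - a ^ 2) * f a = 0)
    (hf : ∀ x ∈ Set.Ioo a b, 0 < f x) : b - a ≤ Real.pi / k := by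
  by_contra! hlt
  have hpk : 0 < Real.pi / k := div_pos Real.pi_pos hk
  have hd := fun x => hasDerivAt_wronskian_sin (k := k) (a := a) (hU x) (hV x)
  have hanti := antitoneOn_of_deriv_nonpos (convex_Icc a (a + Real.pi / k))
    (fun x _ => (hd x).continuousAt.continuousWithinAt)
    (fun x _ => (hd x).differentiableAt.differentiableWithinAt)
    (fun x hx => by
      rw [interior_Icc] at hx
      rw [(hd x).deriv]
      have hs : 0 ≤ Real.sin (k * (x - a)) := by
        apply Real.sin_nonneg_of_nonneg_of_le_pi
        · exact mul_nonneg hk.le (by linarith [hx.1])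
        · rw [mul_comm, ← le_div_iff₀ hk]; linarith [hx.2]
      have := hf x ⟨hx.1, by linarith [hx.2]⟩
      have h1 : k ^ 2 * (1 - x ^ 2) - k ^ 2 ≤ 0 := by nlinarith [mul_nonneg (sq_nonneg k) (sq_nonneg x)]
      exact mul_nonpos_of_nonneg_of_nonpos (mul_nonneg hs this.le) h1)
  have h := hanti (Set.left_mem_Icc.2 (by linarith)) (Set.right_mem_Icc.2 (by linarith))
    (by linarith)
  have hkp : k * (a + Real.pi / k - a) = Real.pi := by field_simp; ring
  simp only [hkp, Real.sin_pi, Real.cos_pi, sub_self, mul_zero, Real.sin_zero, hUa, zero_mul] at h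
  have hpos := hf (a + Real.pi / k) ⟨by linarith, by linarith⟩
  have h1 : 0 < 1 - (a + Real.pi / k) ^ 2 := by nlinarith
  have := mul_pos (mul_pos h1 hpos) hk
  linarith

/-- Sturm comparison, lower bound: where `4 x² < 3`, consecutive zeros of a solution of
`U'' = -k² U / (1 - x²)` are at least `π / (2 k)` apart. -/
lemma le_sturm_gap {f V : ℝ → ℝ} {k a b : ℝ} (hk : 0 < k) (hab : a < b)
    (hU : ∀ x, HasDerivAt (fun x => (1 - x ^ 2) * f x) (V x) x)
    (hV : ∀ x, HasDerivAt V (-k ^ 2 * f x) x)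
    (hx : ∀ x ∈ Set.Ioo a b, 4 * x ^ 2 < 3)
    (hUa : (1 - a ^ 2) * f a = 0) (hUb : (1 - b ^ 2) * f b = 0)
    (hf : ∀ x ∈ Set.Ioo a b, 0 < f x) : Real.pi / (2 * k) ≤ b - a := by
  by_contra! hlt
  rw [lt_div_iff₀ (by positivity)] at hlt
  have hd := fun x => hasDerivAt_wronskian_sin (k := 2 * k) (a := a) (hU x) (hV x)
  have hs : ∀ x ∈ Set.Ioc a b, 0 < Real.sin (2 * k * (x - a)) := by
    intro x hx
    apply Real.sin_pos_of_pos_of_lt_pi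
    · exact mul_pos (by linarith) (by linarith [hx.1])
    · nlinarith [hx.2]
  have hmono := strictMonoOn_of_deriv_pos (convex_Icc a b)
    (fun x _ => (hd x).continuousAt.continuousWithinAt)
    (fun x hx' => by
      rw [interior_Icc] at hx'
      rw [(hd x).deriv]
      refine mul_pos (mul_pos (hs x ⟨hx'.1, hx'.2.le⟩) (hf x hx')) ?_
      nlinarith [hx x hx', sq_pos_of_pos hk])
  have h := hmono (Set.left_mem_Icc.2 hab.le) (Set.right_mem_Icc.2 hab.le) hab
  simp only [sub_self, mul_zero, Real.sin_zero, hUa, hUb, zero_mul, sub_zero] at h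
  have hVb : 0 < V b := pos_of_mul_pos_left h (hs b ⟨hab, le_rfl⟩).le
  have hVanti := antitoneOn_of_deriv_nonpos (convex_Icc a b)
    (fun x _ => (hV x).continuousAt.continuousWithinAt)
    (fun x _ => (hV x).differentiableAt.differentiableWithinAt)
    (fun x hx' => by
      rw [interior_Icc] at hx'
      rw [(hV x).deriv]
      nlinarith [hf x hx', sq_pos_of_pos hk])
  have hUmono := strictMonoOn_of_deriv_pos (convex_Icc a b)
    (fun x _ => (hU x).continuousAt.continuousWithinAt)
    (fun x hx' => by
      rw [interior_Icc] at hx'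
      rw [(hU x).deriv]
      exact hVb.trans_le (hVanti ⟨hx'.1.le, hx'.2.le⟩ (Set.right_mem_Icc.2 hab.le) hx'.2.le))
  have h2 := hUmono (Set.left_mem_Icc.2 hab.le) (Set.right_mem_Icc.2 hab.le) hab
  simp only [hUa, hUb, lt_irrefl] at h2

/-- `a < b` are consecutive LGL nodes of order `N`. -/
def IsLGLGap (N : ℕ) (a b : ℝ) : Prop :=
  -1 ≤ a ∧ a < b ∧ b ≤ 1 ∧ (lglPoly N).eval a = 0 ∧ (lglPoly N).eval b = 0 ∧
    ∀ x ∈ Set.Ioo a b, (lglPoly N).eval x ≠ 0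

lemma lglPoly_eval (N : ℕ) (x : ℝ) :
    (lglPoly N).eval x = (1 - x ^ 2) * (legendrePoly N).derivative.eval x := by
  simp [lglPoly]

/-- Between consecutive LGL nodes, one of `± L_N'` is positive, and `(1 - x²)·(± L_N')` solves the
Sturm–Liouville equation. -/
lemma IsLGLGap.exists_solution {N : ℕ} {a b k : ℝ} (h : IsLGLGap N a b)
    (hk : k ^ 2 = N * (N + 1)) :
    ∃ f V : ℝ → ℝ, (∀ x, HasDerivAt (fun x => (1 - x ^ 2) * f x) (V x) x) ∧
      (∀ x, HasDerivAt V (-k ^ 2 * f x) x) ∧ (1 - a ^ 2) * f a = 0 ∧ (1 - b ^ 2) * f b = 0 ∧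
      ∀ x ∈ Set.Ioo a b, 0 < f x := by
  obtain ⟨-, hab, -, hUa, hUb, hne⟩ := h
  set g : ℝ → ℝ := fun x => (legendrePoly N).derivative.eval x with hg
  set W : ℝ → ℝ := fun x => -k ^ 2 * (legendrePoly N).eval x with hW
  have hU : ∀ x, HasDerivAt (fun x => (1 - x ^ 2) * g x) (W x) x := by
    intro x
    have := (lglPoly N).hasDerivAt x
    rw [derivative_lglPoly] at this
    simp only [lglPoly_eval] at this
    refine this.congr_deriv ?_
    simp [hW, hk]
  have hV : ∀ x, HasDerivAt W (-k ^ 2 * g x) x := fun x =>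
    ((legendrePoly N).hasDerivAt x).const_mul _
  have hg0 : ∀ x ∈ Set.Ioo a b, g x ≠ 0 := fun x hx h0 => hne x hx (by
    rw [lglPoly_eval]; exact mul_eq_zero_of_right _ h0)
  rw [lglPoly_eval] at hUa hUb
  have hcont : Continuous g := (legendrePoly N).derivative.continuous
  have hsign : (∀ x ∈ Set.Ioo a b, 0 < g x) ∨ (∀ x ∈ Set.Ioo a b, g x < 0) := by
    by_contra! hcon
    obtain ⟨⟨x, hx, hx'⟩, y, hy, hy'⟩ := hcon
    obtain ⟨z, hz, hz'⟩ := isPreconnected_Ioo.intermediate_value hx hy hcont.continuousOn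
      ⟨hx', hy'⟩
    exact hg0 z hz hz'
  rcases hsign with hs | hs
  · exact ⟨g, W, hU, hV, hUa, hUb, hs⟩
  · refine ⟨fun x => - g x, fun x => - W x, fun x => ?_, fun x => ?_, ?_, ?_, ?_⟩
    · simpa only [mul_neg] using (hU x).fun_neg
    · simpa only [mul_neg] using (hV x).fun_neg
    · rw [mul_neg, hUa, neg_zero]
    · rw [mul_neg, hUb, neg_zero]
    · exact fun x hx => neg_pos.2 (hs x hx)

lemma IsLGLGap.length_le {N : ℕ} (hN : 1 ≤ N) {a b : ℝ} (h : IsLGLGap N a b) :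
    b - a ≤ Real.pi / √(N * (N + 1)) := by
  have hpos : (0 : ℝ) < N * (N + 1) := by positivity
  obtain ⟨f, V, hU, hV, hUa, -, hf⟩ := h.exists_solution (Real.sq_sqrt hpos.le)
  exact sturm_gap_le (Real.sqrt_pos.2 hpos) hU hV h.1 h.2.2.1 hUa hf

lemma derivative_legendrePoly_two (x : ℝ) :
    (legendrePoly 2).derivative.eval x = 3 * x := by
  have h : legendrePoly 2 = Polynomial.C (1 / 8 : ℝ) *
      Polynomial.derivative^[2] (Polynomial.X ^ 4 - 2 * Polynomial.X ^ 2 + 1) := by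
    rw [legendrePoly]; congr 2
    · norm_num [Nat.factorial]
    · ring
  rw [h]
  simp
  ring

lemma derivative_legendrePoly_three (x : ℝ) :
    (legendrePoly 3).derivative.eval x = (15 * x ^ 2 - 3) / 2 := by
  have h : legendrePoly 3 = Polynomial.C (1 / 48 : ℝ) *
      Polynomial.derivative^[3] (Polynomial.X ^ 6 - 3 * Polynomial.X ^ 4
        + 3 * Polynomial.X ^ 2 - 1) := by
    rw [legendrePoly]; congr 2
    · norm_num [Nat.factorial]
    · ring
  rw [h]
  simp
  ring

lemma IsLGLGap.le_length {N : ℕ} (hN : 2 ≤ N) {a b : ℝ} (h : IsLGLGap N a b)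
    (ha : -1 < a) (ha' : a ≤ 0) (hb : -1 / 2 < b) :
    Real.pi / (2 * √(N * (N + 1))) ≤ b - a := by
  have hpos : (0 : ℝ) < N * (N + 1) := by positivity
  have hsq := Real.sqrt_pos.2 hpos
  by_contra! hlt
  have hlt' := hlt
  rw [lt_div_iff₀ (by positivity)] at hlt
  have hpi := Real.pi_lt_d2
  have hab := h.2.1
  by_cases hN4 : 4 ≤ N
  · have hk : (4.47 : ℝ) ≤ √(N * (N + 1)) := by
      apply Real.le_sqrt_of_sq_le
      have : (4 : ℝ) ≤ N := by exact_mod_cast hN4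
      nlinarith
    have hlen : b - a < 0.36 := by nlinarith
    obtain ⟨f, V, hU, hV, hUa, hUb, hf⟩ := h.exists_solution (Real.sq_sqrt hpos.le)
    refine hlt'.not_ge (le_sturm_gap hsq hab hU hV (fun x hx => ?_) hUa hUb hf)
    nlinarith [hx.1, hx.2]
  · obtain ⟨-, -, hb1, hUa, hUb, -⟩ := h
    rw [lglPoly_eval] at hUa hUb
    have ha2 : 1 - a ^ 2 ≠ 0 := by nlinarith
    have hfa := (mul_eq_zero.1 hUa).resolve_left ha2
    obtain rfl | rfl : N = 2 ∨ N = 3 := by omega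
    · rw [derivative_legendrePoly_two] at hfa hUb
      have hk : (2 : ℝ) ≤ √((2 : ℕ) * ((2 : ℕ) + 1)) := by
        apply Real.le_sqrt_of_sq_le; norm_num
      obtain rfl : a = 0 := by linarith
      have : b = 1 := by
        have h1 : (b - 1) * (b * (1 + b)) = 0 := by linarith
        have h2 : b * (1 + b) ≠ 0 := by positivity
        linarith [(mul_eq_zero.1 h1).resolve_right h2]
      subst this
      linarith
    · rw [derivative_legendrePoly_three] at hfa hUb
      have hk : (3 : ℝ) ≤ √((3 : ℕ) * ((3 : ℕ) + 1)) := by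
        apply Real.le_sqrt_of_sq_le; norm_num
      have ha5 : a < -0.44 := by nlinarith
      have hb5 : 0.44 < b := by
        rcases mul_eq_zero.1 hUb with h1 | h1
        · nlinarith
        · by_contra! hb'
          have h2 : (b - a) * (b + a) = 0 := by linarith
          have := (mul_eq_zero.1 h2).resolve_left (by linarith)
          linarith
      nlinarith

lemma IsLGLNodes.isLGLGap {N : ℕ} {ξ : ℕ → ℝ} (h : IsLGLNodes N ξ) {i : ℕ} (hi : i < N) :
    IsLGLGap N (ξ i) (ξ (i + 1)) := by
  obtain ⟨hmono, h0, h1, hz, hall⟩ := h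
  refine ⟨?_, hmono hi.le (Nat.succ_le_of_lt hi) (Nat.lt_succ_self i), ?_, hz i hi.le,
    hz _ hi, ?_⟩
  · rw [← h0]; exact hmono.monotoneOn (Nat.zero_le N) hi.le (Nat.zero_le i)
  · rw [← h1]; exact hmono.monotoneOn (Nat.succ_le_of_lt hi) Set.self_mem_Iic hi
  · intro x hx hx0
    obtain ⟨k, hk, rfl⟩ := hall x hx0
    have h2 := (hmono.lt_iff_lt hi.le hk).1 hx.1
    have h3 := (hmono.lt_iff_lt hk (Nat.succ_le_of_lt hi)).1 hx.2
    omega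

/-- Every gap of the LGL grid is at most twice as long as a gap whose left endpoint lies in
`(-1, 0]` and whose right endpoint exceeds `-1/2`. -/
lemma IsLGLNodes.gap_le_two_mul_gap {N : ℕ} {ξ : ℕ → ℝ} (h : IsLGLNodes N ξ) {i j : ℕ}
    (hi : i < N) (hj : j < N) (hi0 : 0 < i) (h0 : ξ i ≤ 0) (hb : -1 / 2 < ξ (i + 1)) :
    ξ (j + 1) - ξ j ≤ 2 * (ξ (i + 1) - ξ i) := by
  have hN : 1 ≤ N := by omega
  have ha : -1 < ξ i := by
    rw [← h.2.1]; exact h.1 (Nat.zero_le N) hi.le hi0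
  have h1 := (h.isLGLGap hi).le_length (by omega) ha h0 hb
  have h2 := (h.isLGLGap hj).length_le hN
  calc _ ≤ _ := h2
    _ = 2 * (Real.pi / (2 * √(N * (N + 1)))) := by ring
    _ ≤ _ := by gcongr

namespace Grid

variable {a b : ℝ} (G : Grid a b)

lemma exists_mem_interval {z : ℝ} (hz : z ∈ Set.Icc a b) : ∃ i < G.M, z ∈ G.interval i := by
  have key : ∀ n, 0 < n → z ≤ G.x n → ∃ i < n, z ∈ G.interval i := by
    intro n
    induction n with
    | zero => simp
    | succ n ih =>
      intro _ hn
      by_cases hzn : G.x n ≤ z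
      · exact ⟨n, Nat.lt_succ_self n, hzn, hn⟩
      · rcases Nat.eq_zero_or_pos n with rfl | hpos
        · exact absurd hz.1 (by rwa [G.left] at hzn)
        · obtain ⟨i, hi, hi'⟩ := ih hpos (not_le.1 hzn).le
          exact ⟨i, hi.trans (Nat.lt_succ_self n), hi'⟩
  exact key G.M G.M_pos (G.right.symm ▸ hz.2)

lemma finite_lengths (I : Set ℝ) :
    {d : ℝ | ∃ i < G.M, (G.interval i ∩ I).Nonempty ∧ d = G.x (i + 1) - G.x i}.Finite := by
  refine ((Set.finite_Iio G.M).image fun i => G.x (i + 1) - G.x i).subset ?_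
  rintro d ⟨i, hi, -, rfl⟩
  exact ⟨i, hi, rfl⟩

lemma gmin_le {I : Set ℝ} {i : ℕ} (hi : i < G.M) (h : (G.interval i ∩ I).Nonempty) :
    G.gmin I ≤ G.x (i + 1) - G.x i :=
  csInf_le (G.finite_lengths I).bddBelow ⟨i, hi, h, rfl⟩

lemma exists_gmin_eq {I : Set ℝ} (hI : (Set.Icc a b ∩ I).Nonempty) :
    ∃ i < G.M, (G.interval i ∩ I).Nonempty ∧ G.gmin I = G.x (i + 1) - G.x i := by
  obtain ⟨z, hz, hzI⟩ := hI
  obtain ⟨i, hi, hzi⟩ := G.exists_mem_interval hz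
  have hne : {d : ℝ | ∃ i < G.M, (G.interval i ∩ I).Nonempty ∧
      d = G.x (i + 1) - G.x i}.Nonempty := ⟨_, i, hi, ⟨z, hzi, hzI⟩, rfl⟩
  exact hne.csInf_mem (G.finite_lengths I)

end Grid

lemma mem_dGridSet {a b : ℝ} {P : DyadicPartition a b} {x : ℝ} :
    x ∈ dGridSet P ↔ ∃ p ∈ P.ps, x = a + (b - a) * p.2 / 2 ^ p.1 ∨
      x = a + (b - a) * (p.2 + 1) / 2 ^ p.1 := by
  simp [dGridSet]

/-- A grid point of a dyadic partition is not interior to any of its intervals. -/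
lemma DyadicPartition.notMem_interior_of_mem_dGridSet {a b : ℝ} (hab : a < b)
    (P : DyadicPartition a b) {q : ℕ × ℕ} (hq : q ∈ P.ps) {x : ℝ} (hx : x ∈ dGridSet P) :
    x ∉ interior (dInt a b q) := by
  intro hxq
  obtain ⟨p, hp, hxp⟩ := mem_dGridSet.1 hx
  have hxcl : x ∈ closure (interior (dInt a b p)) := by
    have hlt : a + (b - a) * p.2 / 2 ^ p.1 < a + (b - a) * (p.2 + 1) / 2 ^ p.1 := by
      have := sub_pos.2 hab
      gcongr
      linarith
    rw [dInt, interior_Icc, closure_Ioo hlt.ne]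
    rcases hxp with rfl | rfl
    · exact Set.left_mem_Icc.2 hlt.le
    · exact Set.right_mem_Icc.2 hlt.le
  by_cases hpq : p = q
  · subst hpq
    rw [dInt, interior_Icc] at hxq
    rcases hxp with rfl | rfl
    · exact lt_irrefl _ hxq.1
    · exact lt_irrefl _ hxq.2
  · obtain ⟨y, hy, hy'⟩ := mem_closure_iff.1 hxcl _ isOpen_interior hxq
    have := P.disj p hp q hq hpq
    exact (this ▸ (⟨hy', hy⟩ : y ∈ interior (dInt a b p) ∩ interior (dInt a b q)) :
      y ∈ (∅ : Set ℝ))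

/-- If the stretched image of an endpoint of the dyadic interval `(j, k)` of `[-1,1]` is interior
to the dyadic interval `(i, m)`, then the stretched parent of `(j, k)` is contained in `(i, m)`. -/
lemma stretched_parent_subset {i m j k t : ℕ} (ht : t = k ∨ t = k + 1)
    (h1 : (-1 : ℝ) + 2 * m / 2 ^ i < 2 * (-1 + 2 * t / 2 ^ j) + 1)
    (h2 : 2 * (-1 + 2 * t / 2 ^ j) + 1 < (-1 : ℝ) + 2 * (m + 1) / 2 ^ i) :
    (-1 : ℝ) + 2 * m / 2 ^ i ≤ 2 * (-1 + 2 * ((k / 2 : ℕ) : ℝ) / 2 ^ (j - 1)) + 1 ∧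
      2 * (-1 + 2 * (((k / 2 : ℕ) : ℝ) + 1) / 2 ^ (j - 1)) + 1 ≤ -1 + 2 * (m + 1) / 2 ^ i := by
  have e1 : (m : ℝ) / 2 ^ i < 2 * t / 2 ^ j := by
    rw [mul_div_assoc] at h1 ⊢; linarith [mul_div_assoc (2 : ℝ) t (2 ^ j)]
  have e2 : 2 * (t : ℝ) / 2 ^ j < (m + 1) / 2 ^ i := by
    rw [mul_div_assoc (2 : ℝ) (m + 1)] at h2; linarith [mul_div_assoc (2 : ℝ) t (2 ^ j)]
  rw [div_lt_div_iff₀ (by positivity) (by positivity)] at e1 e2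
  norm_cast at e1 e2
  obtain hj | ⟨e, rfl⟩ : j ≤ i + 1 ∨ ∃ e, j = i + 2 + e := by
    by_cases h : j ≤ i + 1
    · exact .inl h
    · exact .inr ⟨j - (i + 2), by omega⟩
  · exfalso
    obtain ⟨r, hr⟩ := Nat.exists_eq_add_of_le hj
    have hpow : 2 * 2 ^ i = 2 ^ j * 2 ^ r := by rw [← pow_add, ← hr]; ring
    have hj0 : 0 < 2 ^ j := by positivity
    have f1 : m < t * 2 ^ r := by
      refine lt_of_mul_lt_mul_right (a := 2 ^ j) ?_ hj0.le
      calc _ < _ := e1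
        _ = t * (2 * 2 ^ i) := by ring
        _ = _ := by rw [hpow]; ring
    have f2 : t * 2 ^ r < m + 1 := by
      refine lt_of_mul_lt_mul_right (a := 2 ^ j) ?_ hj0.le
      calc _ = t * (2 * 2 ^ i) := by rw [hpow]; ring
        _ = 2 * t * 2 ^ i := by ring
        _ < _ := e2
    omega
  · have hi0 : 0 < 2 ^ (i + 1) := by positivity
    have f1 : 2 * (m * 2 ^ e) < t := by
      refine lt_of_mul_lt_mul_right (a := 2 ^ (i + 1)) ?_ hi0.le
      have e3 : 2 ^ (i + 2 + e) = 2 * 2 ^ e * 2 ^ (i + 1) := by ring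
      calc _ = m * 2 ^ (i + 2 + e) := by rw [e3]; ring
        _ < _ := e1
        _ = _ := by ring
    have f2 : t < 2 * ((m + 1) * 2 ^ e) := by
      refine lt_of_mul_lt_mul_right (a := 2 ^ (i + 1)) ?_ hi0.le
      have e3 : 2 ^ (i + 2 + e) = 2 * 2 ^ e * 2 ^ (i + 1) := by ring
      calc _ = 2 * t * 2 ^ i := by ring
        _ < _ := e2
        _ = _ := by rw [e3]; ring
    have g1 : m * 2 ^ e ≤ k / 2 := by omega
    have g2 : k / 2 + 1 ≤ (m + 1) * 2 ^ e := by omega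
    have g1' : (m : ℝ) * 2 ^ e ≤ (k / 2 : ℕ) := by exact_mod_cast g1
    have g2' : ((k / 2 : ℕ) : ℝ) + 1 ≤ (m + 1) * 2 ^ e := by exact_mod_cast g2
    have hl : i + 2 + e - 1 = i + 1 + e := by omega
    rw [hl]
    have hm : ∀ y : ℝ, 2 * y / 2 ^ i = 2 * (2 * (y * 2 ^ e) / 2 ^ (i + 1 + e)) := by
      intro y
      rw [pow_add, pow_add]
      field_simp
    have k1 : 2 * (m * 2 ^ e : ℝ) / 2 ^ (i + 1 + e) ≤ 2 * ((k / 2 : ℕ) : ℝ) / 2 ^ (i + 1 + e) := by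
      gcongr
    have k2 : 2 * (((k / 2 : ℕ) : ℝ) + 1) / 2 ^ (i + 1 + e)
        ≤ 2 * ((m + 1 : ℝ) * 2 ^ e) / 2 ^ (i + 1 + e) := by
      gcongr
    rw [hm, hm]
    constructor <;> linarith

/-- If `D̂ = [-1 + n h, -1 + (n + 1) h]` satisfies `h > α m(D̂, G)` and its stretched image lies in
`[l, r] ⊆ [-1, 1]`, then `[l, r]` is too long to satisfy `r - l ≤ α m([l, r], G)`. -/
lemma lt_of_stretched_subset {N : ℕ} {ξ : ℕ → ℝ} (hξ : IsLGLNodes N ξ)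
    (G : Grid (-1 : ℝ) 1) (hGM : G.M = N) (hGx : ∀ k ≤ N, G.x k = ξ k)
    (hstr : ∀ i < G.M, ∀ j < G.M,
      G.interval i ⊆ Set.Ioc (-1 : ℝ) (-1 / 2) →
      (Set.Icc (2 * G.x i + 1) (2 * G.x (i + 1) + 1) ∩ G.interval j).Nonempty →
      G.x (j + 1) - G.x j ≤ 2 * (G.x (i + 1) - G.x i))
    {α h l r : ℝ} (hα : 1 ≤ α) (hh : 0 < h) {n : ℕ}
    (hD : α * G.gmin (Set.Icc (-1 + n * h) (-1 + (n + 1) * h)) < h)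
    (hl1 : -1 ≤ l) (hr1 : r ≤ 1)
    (hl : l ≤ 2 * (-1 + n * h) + 1) (hr : 2 * (-1 + (n + 1) * h) + 1 ≤ r) :
    α * G.gmin (Set.Icc l r) < r - l := by
  have hn : 0 ≤ n * h := by positivity
  have hlr : l ≤ r := by linarith
  obtain ⟨i, hi, ⟨z, hzi, hzD⟩, hg⟩ := G.exists_gmin_eq
    (I := Set.Icc (-1 + n * h) (-1 + (n + 1) * h))
    ⟨-1 + n * h, ⟨by linarith, by linarith⟩, Set.left_mem_Icc.2 (by linarith)⟩
  rw [hg] at hD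
  have hlen : 0 < G.x (i + 1) - G.x i :=
    sub_pos.2 (G.mono hi.le (Nat.succ_le_of_lt hi) (Nat.lt_succ_self i))
  suffices hsuff : ∃ j < G.M, (G.interval j ∩ Set.Icc l r).Nonempty ∧
      G.x (j + 1) - G.x j ≤ 2 * (G.x (i + 1) - G.x i) by
    obtain ⟨j, hj, hne, hle⟩ := hsuff
    have := G.gmin_le hj hne
    have : α * G.gmin (Set.Icc l r) ≤ α * (2 * (G.x (i + 1) - G.x i)) := by
      gcongr; linarith
    linarith
  have hIh : G.x (i + 1) - G.x i < h := by nlinarith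
  have hz1 : l ≤ 2 * z + 1 := by linarith [hzD.1]
  have hz2 : 2 * z + 1 ≤ r := by linarith [hzD.2]
  obtain ⟨j, hj, hzj⟩ := G.exists_mem_interval (z := 2 * z + 1) ⟨by linarith, by linarith⟩
  rcases Nat.eq_zero_or_pos i with rfl | hi0
  · refine ⟨0, hi, ⟨-1, ?_, ?_⟩, by linarith⟩
    · exact ⟨G.left.le, by linarith [G.left]⟩
    · have hn0 : n = 0 := by
        by_contra hne
        have : (1 : ℝ) ≤ n := by exact_mod_cast Nat.one_le_iff_ne_zero.2 hne
        have h1 := hzD.1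
        have h2 := hzi.2
        rw [G.left] at hIh
        nlinarith
      subst hn0
      constructor
      · simp only [Nat.cast_zero, zero_mul, add_zero] at hl
        linarith
      · linarith
  · refine ⟨j, hj, ⟨2 * z + 1, hzj, hz1, hz2⟩, ?_⟩
    have hxi : -1 < G.x i := G.left.symm.trans_lt (G.mono (Nat.zero_le _) hi.le hi0)
    by_cases hd : G.x (i + 1) ≤ -1 / 2
    · refine hstr i hi j hj (fun y hy => ⟨hxi.trans_le hy.1, hy.2.trans hd⟩)
        ⟨2 * z + 1, ⟨?_, ?_⟩, hzj⟩
      · linarith [hzi.1]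
      · linarith [hzi.2]
    · subst hGM
      rw [hGx (j + 1) hj, hGx j hj.le, hGx (i + 1) hi, hGx i hi.le]
      refine hξ.gap_le_two_mul_gap hi hj hi0 ?_ ?_
      · rw [← hGx i hi.le]; linarith [hzi.1]
      · rw [← hGx (i + 1) hi]; exact not_le.1 hd

/-- Closedness under stretching of the dyadic output grid: let `G` be the LGL
grid of order `N` on `[-1,1]` and assume it has the stretching property (any
interval of `P(G)` meeting the stretched image `L(I)` of an interval
`I ∈ P(G)` with `I ⊆ (-1,-1/2]` is at most as long as `L(I)`, where
`L(x) = 2x+1`). If `α ≥ 1`, the initial dyadic partition `P₀` has an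
associated grid that is symmetric, monotonic, and closed under stretching, and
`P` is an α-output for `(G,P₀)`, then the dyadic grid associated with `P` is
closed under stretching. -/
theorem dyadic_output_closed_under_stretching (N : ℕ) (hN : 1 ≤ N)
    (ξ : ℕ → ℝ) (hξ : IsLGLNodes N ξ)
    (G : Grid (-1 : ℝ) 1) (hGM : G.M = N) (hGx : ∀ k ≤ N, G.x k = ξ k)
    (hstr : ∀ i < G.M, ∀ j < G.M,
      G.interval i ⊆ Set.Ioc (-1 : ℝ) (-1 / 2) →
      (Set.Icc (2 * G.x i + 1) (2 * G.x (i + 1) + 1) ∩ G.interval j).Nonempty →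
      G.x (j + 1) - G.x j ≤ 2 * (G.x (i + 1) - G.x i))
    (α : ℝ) (hα : 1 ≤ α)
    (P₀ P : DyadicPartition (-1 : ℝ) 1)
    (hP₀sym : P₀.SymmetricGrid) (hP₀mono : P₀.Monotonic)
    (hP₀str : ClosedUnderStretching (-1) 1 (dGridSet P₀))
    (hP : IsAlphaOutput G P₀ P α) :
    ClosedUnderStretching (-1) 1 (dGridSet P) := by
  intro x hx hx0
  norm_num at hx0
  by_contra hy
  obtain ⟨p, hp, hxp⟩ := mem_dGridSet.1 hx
  obtain ⟨j, k⟩ := p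
  obtain ⟨t, ht, hxt⟩ : ∃ t : ℕ, (t = k ∨ t = k + 1) ∧ x = -1 + 2 * t / 2 ^ j := by
    rcases hxp with h | h
    · exact ⟨k, .inl rfl, by rw [h]; norm_num⟩
    · exact ⟨k + 1, .inr rfl, by rw [h]; push_cast; norm_num⟩
  have hx1 : -1 ≤ x := by rw [hxt]; linarith [show (0 : ℝ) ≤ 2 * t / 2 ^ j by positivity]
  have hmem : 2 * x - (-1) ∈ Set.Icc (-1 : ℝ) 1 := ⟨by linarith, by linarith⟩
  rw [← P.cover] at hmem
  simp only [Set.mem_iUnion] at hmem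
  obtain ⟨q, hq, hyq⟩ := hmem
  have hyint : 2 * x - (-1) ∈ interior (dInt (-1) 1 q) := by
    rw [dInt, interior_Icc]
    refine ⟨lt_of_le_of_ne hyq.1 fun h => hy ?_, lt_of_le_of_ne hyq.2 fun h => hy ?_⟩
    · exact mem_dGridSet.2 ⟨q, hq, .inl h.symm⟩
    · exact mem_dGridSet.2 ⟨q, hq, .inr h⟩
  obtain ⟨hPa, hPb, hPc⟩ := hP
  have hp0 : (j, k) ∉ P₀.ps := by
    intro hp0
    have hyP₀ := hP₀str x (mem_dGridSet.2 ⟨_, hp0, hxp⟩) (by norm_num; exact hx0)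
    obtain ⟨q₀, hq₀, hsub⟩ := hPa q hq
    exact P₀.notMem_interior_of_mem_dGridSet (by norm_num) hq₀ hyP₀ (interior_mono hsub hyint)
  obtain ⟨-, hpar⟩ := hPc _ hp hp0
  have hqb := hPb q hq
  have hqv := P.valid q hq
  obtain ⟨i, m⟩ := q
  simp only [dInt, dLen, dParent, interior_Icc, Set.mem_Ioo,
    show (1 : ℝ) - -1 = 2 by norm_num] at hyint hqb hpar hqv
  rw [sub_neg_eq_add, hxt] at hyint
  obtain ⟨hs1, hs2⟩ := stretched_parent_subset ht hyint.1 hyint.2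
  have hm1 : (m : ℝ) + 1 ≤ 2 ^ i := by exact_mod_cast hqv
  have hcomm : ∀ (y : ℝ) (e : ℕ), 2 * y / 2 ^ e = y * (2 / 2 ^ e) := fun y e => by ring
  have hr1 : 2 * ((m : ℝ) + 1) / 2 ^ i ≤ 2 := by
    rw [div_le_iff₀ (by positivity)]; linarith
  rw [hcomm ((k / 2 : ℕ) : ℝ), hcomm (((k / 2 : ℕ) : ℝ) + 1)] at hpar
  rw [hcomm ((k / 2 : ℕ) : ℝ)] at hs1
  rw [hcomm (((k / 2 : ℕ) : ℝ) + 1)] at hs2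
  have hfinal := lt_of_stretched_subset hξ G hGM hGx hstr hα (by positivity) hpar
    (by linarith [show (0 : ℝ) ≤ 2 * m / 2 ^ i by positivity]) (by linarith) hs1 hs2
  have hlen : (-1 + 2 * ((m : ℝ) + 1) / 2 ^ i) - (-1 + 2 * m / 2 ^ i) = 2 / 2 ^ i := by ring
  linarith
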